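/- arXiv:1609.04593 — 3 statements merged into one kernel-verified Lean document; each statement's English description precedes it below -/
import Mathlib

section
/- There exists a connected graph G with a shortest path of eccentricity 1, an arbitrary start vertex r, and a valid run of double-BFS from r producing a shortest path whose eccentricity equals 5; hence the 5-approximation bound for double-BFS is tight. -/
open SimpleGraph

variable {V : Type*}

/-- Distance from a vertex `x` to (the support of) a walk `p`. -/
noncomputable def walkDist (G : SimpleGraph V) {u v : V} (x : V) (p : G.Walk u v) : ℕ :=
  sInf {n | ∃ w ∈ p.support, G.dist x w = n}

/-- A walk is a shortest path when its length equals the distance between its ends. -/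
noncomputable def IsShortestPath (G : SimpleGraph V) {u v : V} (p : G.Walk u v) : Prop :=
  p.length = G.dist u v

/-- Eccentricity of a walk: the largest distance from any vertex to the walk. -/
noncomputable def walkEcc [Fintype V] (G : SimpleGraph V) {u v : V} (p : G.Walk u v) : ℕ :=
  sSup {n | ∃ x : V, walkDist G x p = n}

/-- A diameter: a shortest path of maximum length among all distances. -/
noncomputable def IsDiameter [Fintype V] (G : SimpleGraph V) {u v : V} (p : G.Walk u v) : Prop :=
  IsShortestPath G p ∧ ∀ a b : V, G.dist a b ≤ p.length

/-- `k(G)`: minimum eccentricity over all shortest paths. -/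
noncomputable def minK [Fintype V] (G : SimpleGraph V) : ℕ :=
  sInf {n | ∃ (u v : V) (p : G.Walk u v), IsShortestPath G p ∧ walkEcc G p = n}

/-- `l(G)`: minimum eccentricity over all diameters. -/
noncomputable def minL [Fintype V] (G : SimpleGraph V) : ℕ :=
  sInf {n | ∃ (u v : V) (p : G.Walk u v), IsDiameter G p ∧ walkEcc G p = n}

/-- `s(G)`: maximum eccentricity over all diameters. -/
noncomputable def maxS [Fintype V] (G : SimpleGraph V) : ℕ :=
  sSup {n | ∃ (u v : V) (p : G.Walk u v), IsDiameter G p ∧ walkEcc G p = n}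


/-- Distance table of the example graph on 14 vertices. -/
def exTable : List (List ℕ) :=
  [[0, 1, 2, 3, 4, 5, 6, 7, 3, 3, 2, 1, 4, 4],
   [1, 0, 1, 2, 3, 4, 5, 6, 2, 2, 1, 2, 3, 3],
   [2, 1, 0, 1, 2, 3, 4, 5, 1, 1, 2, 3, 2, 2],
   [3, 2, 1, 0, 1, 2, 3, 4, 2, 2, 3, 4, 3, 1],
   [4, 3, 2, 1, 0, 1, 2, 3, 3, 3, 4, 5, 2, 2],
   [5, 4, 3, 2, 1, 0, 1, 2, 2, 4, 3, 4, 1, 3],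
   [6, 5, 4, 3, 2, 1, 0, 1, 3, 5, 4, 5, 2, 4],
   [7, 6, 5, 4, 3, 2, 1, 0, 4, 6, 5, 6, 3, 5],
   [3, 2, 1, 2, 3, 2, 3, 4, 0, 2, 1, 2, 1, 3],
   [3, 2, 1, 2, 3, 4, 5, 6, 2, 0, 3, 4, 3, 1],
   [2, 1, 2, 3, 4, 3, 4, 5, 1, 3, 0, 1, 2, 4],
   [1, 2, 3, 4, 5, 4, 5, 6, 2, 4, 1, 0, 3, 5],
   [4, 3, 2, 3, 2, 1, 2, 3, 1, 3, 2, 3, 0, 4],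
   [4, 3, 2, 1, 2, 3, 4, 5, 3, 1, 4, 5, 4, 0]]

def exD (a b : Fin 14) : ℕ := (exTable.getD a.val []).getD b.val 0

/-- The example graph: two vertices are adjacent iff their tabulated distance is one. -/
def exG : SimpleGraph (Fin 14) where
  Adj a b := exD a b = 1
  symm := ⟨by decide⟩
  loopless := ⟨by decide⟩

instance : DecidableRel exG.Adj := fun a b => inferInstanceAs (Decidable (exD a b = 1))

theorem exD_self : ∀ a, exD a a = 0 := by decide

set_option maxRecDepth 100000 in
theorem exD_step : ∀ a b c, exG.Adj a b → exD a c ≤ exD b c + 1 := by decide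

set_option maxRecDepth 100000 in
theorem exD_pred : ∀ a c, a = c ∨ ∃ b, exG.Adj a b ∧ exD a c = exD b c + 1 := by decide

theorem exD_le {a b : Fin 14} (p : exG.Walk a b) : exD a b ≤ p.length := by
  induction p with
  | nil => simp [exD_self]
  | cons h p ih =>
    have := exD_step _ _ _ h |>.trans (Nat.add_le_add_right ih 1)
    simpa using this

theorem exD_walk (k : ℕ) : ∀ a b : Fin 14, exD a b = k → ∃ p : exG.Walk a b, p.length = k := by
  induction k with
  | zero =>
    intro a b h
    rcases exD_pred a b with rfl | ⟨c, -, hc⟩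
    · exact ⟨.nil, rfl⟩
    · omega
  | succ k ih =>
    intro a b h
    rcases exD_pred a b with rfl | ⟨c, hac, hc⟩
    · simp [exD_self] at h
    · obtain ⟨p, hp⟩ := ih c b (by omega)
      exact ⟨.cons hac p, by simp [hp]⟩

theorem exG_connected : exG.Connected := by
  have : Nonempty (Fin 14) := ⟨0⟩
  exact ⟨fun a b => (exD_walk _ a b rfl).elim fun p _ => ⟨p⟩⟩

theorem exG_dist (a b : Fin 14) : exG.dist a b = exD a b := by
  obtain ⟨p, hp⟩ := exD_walk _ a b rfl
  obtain ⟨q, hq⟩ := exG_connected.exists_walk_length_eq_dist a b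
  have h1 := exG.dist_le p
  have h2 := exD_le q
  omega

/-- Compute the eccentricity of a walk from a support list. -/
theorem exG_ecc {u v : Fin 14} (p : exG.Walk u v) (k : ℕ)
    (h1 : ∀ x, ∃ w ∈ p.support, exD x w ≤ k)
    (h2 : ∃ x, ∀ w ∈ p.support, k ≤ exD x w) : walkEcc exG p = k := by
  have hle : ∀ x, walkDist exG x p ≤ k := by
    intro x
    obtain ⟨w, hw, hk⟩ := h1 x
    have h : walkDist exG x p ≤ exG.dist x w := by
      unfold walkDist
      exact Nat.sInf_le ⟨w, hw, rfl⟩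
    rw [exG_dist] at h
    exact h.trans hk
  obtain ⟨x, hx⟩ := h2
  have hge : k ≤ walkDist exG x p := by
    have hne : {n | ∃ w ∈ p.support, exG.dist x w = n}.Nonempty :=
      ⟨_, u, p.start_mem_support, rfl⟩
    obtain ⟨w, hw, he⟩ := Nat.sInf_mem hne
    have := hx w hw
    rw [← exG_dist] at this
    unfold walkDist
    omega
  unfold walkEcc
  apply le_antisymm
  · refine csSup_le ⟨walkDist exG x p, x, rfl⟩ ?_
    rintro n ⟨y, rfl⟩
    exact hle y
  · refine hge.trans (le_csSup ⟨k, ?_⟩ ⟨x, rfl⟩)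
    rintro n ⟨y, rfl⟩
    exact hle y

def exP : exG.Walk 0 7 :=
  .cons (u := 0) (by decide) (.cons (u := 1) (by decide) (.cons (u := 2) (by decide) (.cons (u := 3) (by decide) (.cons (u := 4) (by decide) (.cons (u := 5) (by decide) (.cons (u := 6) (by decide) (.nil)))))))

def exQ : exG.Walk 13 11 :=
  .cons (u := 13) (by decide) (.cons (u := 9) (by decide) (.cons (u := 2) (by decide) (.cons (u := 1) (by decide) (.cons (u := 0) (by decide) (.nil)))))

theorem stmt3 :
    ∃ (V : Type) (_ : Fintype V) (G : SimpleGraph V), G.Connected ∧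
      (∃ (u v : V) (P : G.Walk u v), IsShortestPath G P ∧ walkEcc G P = 1) ∧
      (∃ (r x y : V) (Q : G.Walk x y),
        (∀ w : V, G.dist r w ≤ G.dist r x) ∧
        (∀ w : V, G.dist x w ≤ G.dist x y) ∧
        IsShortestPath G Q ∧ walkEcc G Q = 5) := by 
  refine ⟨Fin 14, inferInstance, exG, exG_connected, ⟨0, 7, exP, ?_, ?_⟩,
    12, 13, 11, exQ, ?_, ?_, ?_, ?_⟩
  · unfold IsShortestPath
    rw [exG_dist]; decide
  · apply exG_ecc
    · decide
    · decide
  · simp only [exG_dist]; decide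
  · simp only [exG_dist]; decide
  · unfold IsShortestPath
    rw [exG_dist]; decide
  · apply exG_ecc
    · decide
    · decide
end

section
/- Let G be a connected graph with a shortest path v_0,...,v_t of eccentricity k, let x,y be vertices of G, Q a shortest x-y path, and define i_min, i_max as the extreme indices i with d(v_i,{x,y}) ≤ k. If z is a vertex with d(z,Q) > 3k and v_{i_z} is a path vertex with d(z,v_{i_z}) ≤ k, then i_z ≤ i_min - k or i_z ≥ i_max + k. -/
open SimpleGraph

variable {V : Type*}

theorem aux_up (G : SimpleGraph V) (hG : G.Connected) {a b : V} (P : G.Walk a b) (i n : ℕ) :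
    G.dist (P.getVert i) (P.getVert (i + n)) ≤ n := by
  induction n with
  | zero => simp
  | succ n ih =>
    have h1 : G.dist (P.getVert (i + n)) (P.getVert (i + n + 1)) ≤ 1 := by
      by_cases h : i + n < P.length
      · exact (SimpleGraph.dist_eq_one_iff_adj.mpr (P.adj_getVert_succ h)).le
      · rw [P.getVert_of_length_le (by omega), P.getVert_of_length_le (by omega)]
        simp
    have h2 := hG.dist_triangle (u := P.getVert i) (v := P.getVert (i + n))
      (w := P.getVert (i + n + 1))
    rw [← add_assoc]
    omega

theorem aux_low (G : SimpleGraph V) (hG : G.Connected) {a b : V} (P : G.Walk a b)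
    (hP : IsShortestPath G P) (i j : ℕ) (hij : i ≤ j) (hj : j ≤ P.length) :
    j ≤ i + G.dist (P.getVert i) (P.getVert j) := by
  have h1 := aux_up G hG P 0 i
  have h2 := aux_up G hG P j (P.length - j)
  rw [Nat.add_sub_cancel' hj, P.getVert_length] at h2
  rw [zero_add, P.getVert_zero] at h1
  have h3 := hG.dist_triangle (u := a) (v := P.getVert i) (w := b)
  have h4 := hG.dist_triangle (u := P.getVert i) (v := P.getVert j) (w := b)
  unfold IsShortestPath at hP
  omega

theorem aux_cov (G : SimpleGraph V) {a b : V} (P : G.Walk a b) (q : V) (k : ℕ)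
    (h : walkDist G q P ≤ k) : ∃ j ≤ P.length, G.dist (P.getVert j) q ≤ k := by
  have hne : {n | ∃ w ∈ P.support, G.dist q w = n}.Nonempty := ⟨_, a, P.start_mem_support, rfl⟩
  obtain ⟨w, hw, hd⟩ := Nat.sInf_mem hne
  obtain ⟨j, hj, hjl⟩ := SimpleGraph.Walk.mem_support_iff_exists_getVert.mp hw
  refine ⟨j, hjl, ?_⟩
  rw [hj, SimpleGraph.dist_comm, hd]
  exact h

theorem stmt6 [Fintype V] (G : SimpleGraph V) (hG : G.Connected)
    {v0 vt : V} (P : G.Walk v0 vt) (hP : IsShortestPath G P) (k : ℕ)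
    (hecc : ∀ z : V, walkDist G z P ≤ k)
    (x y : V) (Q : G.Walk x y) (hQ : IsShortestPath G Q)
    (imin imax : ℕ)
    (himin1 : imin ≤ P.length)
    (himin2 : min (G.dist (P.getVert imin) x) (G.dist (P.getVert imin) y) ≤ k)
    (himin3 : ∀ i < imin, ¬ min (G.dist (P.getVert i) x) (G.dist (P.getVert i) y) ≤ k)
    (himax1 : imax ≤ P.length)
    (himax2 : min (G.dist (P.getVert imax) x) (G.dist (P.getVert imax) y) ≤ k)
    (himax3 : ∀ i, i ≤ P.length → imax < i →
      ¬ min (G.dist (P.getVert i) x) (G.dist (P.getVert i) y) ≤ k)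
    (z : V) (hz : 3 * k < walkDist G z Q)
    (iz : ℕ) (hiz : iz ≤ P.length) (hziz : G.dist z (P.getVert iz) ≤ k) :
    iz + k ≤ imin ∨ imax + k ≤ iz := by
  have far : ∀ q ∈ Q.support, 3 * k < G.dist z q := fun q hq =>
    lt_of_lt_of_le hz (Nat.sInf_le ⟨q, hq, rfl⟩)
  have up : ∀ i j, i ≤ j → G.dist (P.getVert i) (P.getVert j) ≤ j - i := by
    intro i j hij
    have := aux_up G hG P i (j - i)
    rwa [Nat.add_sub_cancel' hij] at this
  -- indices near Q are far from iz
  have key : ∀ q ∈ Q.support, ∀ j, G.dist (P.getVert j) q ≤ k → iz + k < j ∨ j + k < iz := by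
    intro q hq j hj
    by_contra hcon
    have h1 : G.dist (P.getVert iz) (P.getVert j) ≤ k := by
      rcases le_total iz j with h | h
      · have := up _ _ h
        omega
      · have := up _ _ h
        rw [SimpleGraph.dist_comm]
        omega
    have h2 := hG.dist_triangle (u := z) (v := P.getVert iz) (w := q)
    have h3 := hG.dist_triangle (u := P.getVert iz) (v := P.getVert j) (w := q)
    have := far q hq
    omega
  have hstep : ∀ q ∈ Q.support, ∀ q' ∈ Q.support, G.dist q q' ≤ 1 →
      (∃ j, j ≤ iz ∧ G.dist (P.getVert j) q ≤ k) →
      (∃ j, iz ≤ j ∧ j ≤ P.length ∧ G.dist (P.getVert j) q' ≤ k) → False := by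
    rintro q hq q' hq' hqq ⟨j, hj, hd⟩ ⟨j', hj', hl, hd'⟩
    have h1 := key q hq j hd
    have h2 := key q' hq' j' hd'
    have h3 := aux_low G hG P hP j j' (by omega) hl
    have h4 := hG.dist_triangle (u := P.getVert j) (v := q) (w := P.getVert j')
    have h5 := hG.dist_triangle (u := q) (v := q') (w := P.getVert j')
    rw [SimpleGraph.dist_comm (u := q') (v := P.getVert j')] at h5
    omega
  have hcov : ∀ q, (∃ j, j ≤ iz ∧ G.dist (P.getVert j) q ≤ k) ∨
      (∃ j, iz ≤ j ∧ j ≤ P.length ∧ G.dist (P.getVert j) q ≤ k) := by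
    intro q
    obtain ⟨j, hj, hd⟩ := aux_cov G P q k (hecc q)
    rcases le_total j iz with h | h
    · exact Or.inl ⟨j, h, hd⟩
    · exact Or.inr ⟨j, h, hj, hd⟩
  have hmove : ∀ q ∈ Q.support, ∀ q' ∈ Q.support, G.dist q q' ≤ 1 →
      (∃ j, j ≤ iz ∧ G.dist (P.getVert j) q ≤ k) →
      (∃ j, j ≤ iz ∧ G.dist (P.getVert j) q' ≤ k) := by
    intro q hq q' hq' hqq hl
    exact (hcov q').resolve_right (fun h => hstep q hq q' hq' hqq hl h)
  have hall : ∀ m, ((∃ j, j ≤ iz ∧ G.dist (P.getVert j) (Q.getVert m) ≤ k) ↔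
      (∃ j, j ≤ iz ∧ G.dist (P.getVert j) x ≤ k)) := by
    intro m
    induction m with
    | zero => rw [Q.getVert_zero]
    | succ m ih =>
      rw [← ih]
      have h1 := aux_up G hG Q m 1
      exact ⟨hmove _ (Q.getVert_mem_support _) _ (Q.getVert_mem_support _)
          (by rwa [SimpleGraph.dist_comm]),
        hmove _ (Q.getVert_mem_support _) _ (Q.getVert_mem_support _) h1⟩
  have hxy := hall Q.length
  rw [Q.getVert_length] at hxy
  have hx := Q.start_mem_support
  have hy := Q.end_mem_support
  by_contra hcon
  have h1 : imin ≤ iz := by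
    rcases min_le_iff.mp himin2 with h | h
    · have := key x hx _ h
      omega
    · have := key y hy _ h
      omega
  have h2 : iz ≤ imax := by
    rcases min_le_iff.mp himax2 with h | h
    · have := key x hx _ h
      omega
    · have := key y hy _ h
      omega
  have hlo : ∃ j, j ≤ iz ∧ G.dist (P.getVert j) x ≤ k := by
    rcases min_le_iff.mp himin2 with h | h
    · exact ⟨imin, h1, h⟩
    · exact hxy.mp ⟨imin, h1, h⟩
  rcases min_le_iff.mp himax2 with h | h
  · exact hstep x hx x hx (by simp) hlo ⟨imax, h2, himax1, h⟩
  · exact hstep y hy y hy (by simp) (hxy.mpr hlo) ⟨imax, h2, himax1, h⟩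
end

section
/- For every integer k ≥ 1 there exists a connected graph J_k such that k(J_k) = k and s(J_k) = 4k, i.e., J_k contains a shortest path of eccentricity k while some diameter of J_k has eccentricity exactly 4k. Hence the bound s(G) ≤ 4k(G) is tight. -/
open SimpleGraph

variable {V : Type*}

namespace JK

/-! ### The general bound `s(G) ≤ 4 k(G)` -/

section general
variable {W : Type*} {G : SimpleGraph W}

lemma walkDist_le_iff {u v : W} (x : W) (p : G.Walk u v) (n : ℕ) :
    walkDist G x p ≤ n ↔ ∃ w ∈ p.support, G.dist x w ≤ n := by
  unfold walkDist
  constructor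
  · intro h
    have hne : {n | ∃ w ∈ p.support, G.dist x w = n}.Nonempty :=
      ⟨_, u, p.start_mem_support, rfl⟩
    obtain ⟨w, hw, he⟩ := Nat.sInf_mem hne
    exact ⟨w, hw, by omega⟩
  · rintro ⟨w, hw, he⟩
    exact le_trans (Nat.sInf_le ⟨w, hw, rfl⟩) he

lemma walkDist_le_ecc [Fintype W] {u v : W} (x : W) (p : G.Walk u v) :
    walkDist G x p ≤ walkEcc G p := by
  unfold walkEcc
  apply le_csSup
  · exact (Set.finite_range fun x => walkDist G x p).bddAbove
  · exact ⟨x, rfl⟩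

lemma walkEcc_le_iff [Fintype W] {u v : W} (p : G.Walk u v) (n : ℕ) :
    walkEcc G p ≤ n ↔ ∀ x, ∃ w ∈ p.support, G.dist x w ≤ n := by
  constructor
  · intro h x
    exact (walkDist_le_iff x p n).1 (le_trans (walkDist_le_ecc x p) h)
  · intro h
    unfold walkEcc
    refine csSup_le ⟨walkDist G u p, u, rfl⟩ ?_
    rintro _ ⟨x, rfl⟩
    exact (walkDist_le_iff x p n).2 (h x)

lemma dist_getVert_le (hG : G.Connected) {u v : W} (p : G.Walk u v) (i d : ℕ)
    (h : i + d ≤ p.length) : G.dist (p.getVert i) (p.getVert (i + d)) ≤ d := by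
  induction d with
  | zero => simp
  | succ d ih =>
    have h1 := ih (by omega)
    have h2 : G.dist (p.getVert (i + d)) (p.getVert (i + d + 1)) = 1 :=
      SimpleGraph.dist_eq_one_iff_adj.2 (p.adj_getVert_succ (by omega))
    have h3 := hG.dist_triangle (u := p.getVert i) (v := p.getVert (i + d))
      (w := p.getVert (i + d + 1))
    rw [← add_assoc]
    omega

lemma dist_getVert_ge (hG : G.Connected) {u v : W} (p : G.Walk u v)
    (hp : p.length = G.dist u v) (i d : ℕ)
    (h : i + d ≤ p.length) : d ≤ G.dist (p.getVert i) (p.getVert (i + d)) := by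
  have h1 := dist_getVert_le hG p 0 i (by omega)
  have h2 := dist_getVert_le hG p (i + d) (p.length - (i + d)) (by omega)
  have e : i + d + (p.length - (i + d)) = p.length := by omega
  rw [e, SimpleGraph.Walk.getVert_length] at h2
  rw [zero_add, SimpleGraph.Walk.getVert_zero] at h1
  have h3 := hG.dist_triangle (u := u) (v := p.getVert i) (w := v)
  have h4 := hG.dist_triangle (u := p.getVert i) (v := p.getVert (i + d)) (w := v)
  omega

lemma dist_getVert (hG : G.Connected) {u v : W} (p : G.Walk u v)
    (hp : p.length = G.dist u v) (i j : ℕ) (hi : i ≤ p.length) (hj : j ≤ p.length) :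
    G.dist (p.getVert i) (p.getVert j) = (j - i) + (i - j) := by
  rcases le_total i j with h | h
  · obtain ⟨d, rfl⟩ := Nat.exists_eq_add_of_le h
    have h1 := dist_getVert_le hG p i d hj
    have h2 := dist_getVert_ge hG p hp i d hj
    omega
  · obtain ⟨d, rfl⟩ := Nat.exists_eq_add_of_le h
    have h1 := dist_getVert_le hG p j d hi
    have h2 := dist_getVert_ge hG p hp j d hi
    rw [SimpleGraph.dist_comm]
    omega

/-- Every diameter has eccentricity at most `4k` when some shortest path has eccentricity `≤ k`. -/
lemma ecc_diam_le [Fintype W] (hG : G.Connected) {u v a b : W} (p : G.Walk u v)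
    (hp : IsShortestPath G p) (D : G.Walk a b) (hD : IsDiameter G D) (k : ℕ)
    (hk : walkEcc G p ≤ k) : walkEcc G D ≤ 4 * k := by
  have hp' : p.length = G.dist u v := hp
  have hDl : D.length = G.dist a b := hD.1
  rw [walkEcc_le_iff] at hk ⊢
  have hproj : ∀ x, ∃ i, i ≤ p.length ∧ G.dist x (p.getVert i) ≤ k := by
    intro x
    obtain ⟨w, hw, hd⟩ := hk x
    obtain ⟨i, hi, hl⟩ := SimpleGraph.Walk.mem_support_iff_exists_getVert.1 hw
    exact ⟨i, hl, by rw [hi]; exact hd⟩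
  choose f hf hfd using hproj
  have hcmp : ∀ x y, (f y - f x) + (f x - f y) ≤ G.dist x y + 2 * k := by
    intro x y
    have h0 := dist_getVert hG p hp' (f x) (f y) (hf x) (hf y)
    have h1 := hG.dist_triangle (u := p.getVert (f x)) (v := x) (w := p.getVert (f y))
    have h2 := hG.dist_triangle (u := x) (v := y) (w := p.getVert (f y))
    have h3 := hfd x
    have h4 := hfd y
    rw [SimpleGraph.dist_comm] at h3
    omega
  have hcmp' : ∀ x y, G.dist x y ≤ (f y - f x) + (f x - f y) + 2 * k := by
    intro x y
    have h0 := dist_getVert hG p hp' (f x) (f y) (hf x) (hf y)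
    have h1 := hG.dist_triangle (u := x) (v := p.getVert (f x)) (w := y)
    have h2 := hG.dist_triangle (u := p.getVert (f x)) (v := p.getVert (f y)) (w := y)
    have h3 := hfd x
    have h4 := hfd y
    rw [SimpleGraph.dist_comm] at h4
    omega
  intro x
  by_contra hcon
  push Not at hcon
  have hfar : ∀ m, 4 * k < G.dist x (D.getVert m) := fun m => hcon _ (D.getVert_mem_support m)
  have hstep : ∀ m, m < D.length → G.dist (D.getVert m) (D.getVert (m + 1)) = 1 := fun m hm =>
    SimpleGraph.dist_eq_one_iff_adj.2 (D.adj_getVert_succ hm)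
  have hlen := hD.2 u v
  have hab := hcmp' a b
  have hx := hf x
  have h0 := hcmp' x (D.getVert 0)
  have h0' := hfar 0
  rcases Nat.lt_or_ge (f (D.getVert 0)) (f x) with hlt | hge
  · have hall : ∀ m, m ≤ D.length → f (D.getVert m) + 2 * k < f x := by
      intro m
      induction m with
      | zero => intro _; omega
      | succ m ih =>
        intro hm
        have := ih (by omega)
        have h1 := hstep m (by omega)
        have h2 := hcmp (D.getVert m) (D.getVert (m + 1))
        have h3 := hcmp' x (D.getVert (m + 1))
        have h4 := hfar (m + 1)
        omega
    have e1 := hall 0 (by omega)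
    have e2 := hall D.length le_rfl
    rw [SimpleGraph.Walk.getVert_zero] at e1
    rw [SimpleGraph.Walk.getVert_length] at e2
    omega
  · have hall : ∀ m, m ≤ D.length → f x + 2 * k < f (D.getVert m) := by
      intro m
      induction m with
      | zero => intro _; omega
      | succ m ih =>
        intro hm
        have := ih (by omega)
        have h1 := hstep m (by omega)
        have h2 := hcmp (D.getVert m) (D.getVert (m + 1))
        have h3 := hcmp' x (D.getVert (m + 1))
        have h4 := hfar (m + 1)
        omega
    have e1 := hall 0 (by omega)
    have e2 := hall D.length le_rfl
    rw [SimpleGraph.Walk.getVert_zero] at e1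
    rw [SimpleGraph.Walk.getVert_length] at e2
    have := hf a
    have := hf b
    omega

/-- It suffices to find one good path and one bad diameter. -/
lemma main_reduction [Fintype W] (hG : G.Connected) (k : ℕ) {u v a b : W} (p : G.Walk u v)
    (hp : IsShortestPath G p) (D : G.Walk a b) (hD : IsDiameter G D)
    (hk : walkEcc G p ≤ k) (hs : 4 * k ≤ walkEcc G D) :
    minK G = k ∧ maxS G = 4 * k := by
  have hge : ∀ (u' v' : W) (q : G.Walk u' v'), IsShortestPath G q → k ≤ walkEcc G q := by
    intro u' v' q hq
    have := ecc_diam_le hG q hq D hD _ le_rfl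
    omega
  constructor
  · apply le_antisymm
    · exact le_trans (Nat.sInf_le ⟨u, v, p, hp, rfl⟩) hk
    · refine le_csInf ⟨walkEcc G p, u, v, p, hp, rfl⟩ ?_
      rintro _ ⟨u', v', q, hq, rfl⟩
      exact hge _ _ q hq
  · have hub : ∀ n ∈ {n | ∃ (u v : W) (p : G.Walk u v), IsDiameter G p ∧ walkEcc G p = n},
        n ≤ 4 * k := by
      rintro _ ⟨u', v', q, hq, rfl⟩
      exact ecc_diam_le hG p hp q hq k hk
    apply le_antisymm
    · exact csSup_le ⟨_, a, b, D, hD, rfl⟩ hub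
    · exact le_trans hs (le_csSup ⟨_, hub⟩ ⟨a, b, D, hD, rfl⟩)

/-- A walk from a sequence of consecutively adjacent vertices. -/
lemma exists_walk_seq (f : ℕ → W) (n : ℕ) (h : ∀ i < n, G.Adj (f i) (f (i + 1))) :
    ∃ p : G.Walk (f 0) (f n), p.length = n ∧ ∀ w, w ∈ p.support ↔ ∃ i ≤ n, f i = w := by
  induction n with
  | zero =>
    refine ⟨SimpleGraph.Walk.nil, rfl, fun w => ?_⟩
    simp [eq_comm]
  | succ n ih =>
    obtain ⟨p, hl, hs⟩ := ih fun i hi => h i (by omega)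
    refine ⟨p.concat (h n (by omega)), by simp [hl], fun w => ?_⟩
    rw [SimpleGraph.Walk.support_concat]
    simp only [List.mem_append, List.mem_singleton, hs]
    constructor
    · rintro (⟨i, hi, rfl⟩ | rfl)
      · exact ⟨i, by omega, rfl⟩
      · exact ⟨n + 1, le_rfl, rfl⟩
    · rintro ⟨i, hi, rfl⟩
      rcases Nat.lt_or_ge n i with h' | h'
      · right
        congr 1
        omega
      · exact Or.inl ⟨i, h', rfl⟩

/-- There is a walk of length at most `n`. -/
def Near (G : SimpleGraph W) (n : ℕ) (x y : W) : Prop := ∃ w : G.Walk x y, w.length ≤ n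

lemma Near.trans {m n : ℕ} {x y z : W} (h : Near G m x y) (h' : Near G n y z) :
    Near G (m + n) x z := by
  obtain ⟨w, hw⟩ := h
  obtain ⟨w', hw'⟩ := h'
  exact ⟨w.append w', by rw [SimpleGraph.Walk.length_append]; omega⟩

lemma Near.symm {n : ℕ} {x y : W} (h : Near G n x y) : Near G n y x := by
  obtain ⟨w, hw⟩ := h
  exact ⟨w.reverse, by simpa using hw⟩

lemma Near.mono {m n : ℕ} {x y : W} (h : Near G m x y) (hmn : m ≤ n) : Near G n x y := by
  obtain ⟨w, hw⟩ := h
  exact ⟨w, by omega⟩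

lemma Near.dist_le {n : ℕ} {x y : W} (h : Near G n x y) : G.dist x y ≤ n := by
  obtain ⟨w, hw⟩ := h
  exact (SimpleGraph.dist_le w).trans hw

/-- A function changing by at most one along edges gives a lower bound on distances. -/
lemma lip_dist (hG : G.Connected) (φ : W → ℕ) (hφ : ∀ x y, G.Adj x y → φ y ≤ φ x + 1) (x y : W) :
    φ y ≤ φ x + G.dist x y := by
  obtain ⟨w, hw⟩ := hG.exists_walk_length_eq_dist x y
  rw [← hw]
  clear hw
  induction w with
  | nil => simp
  | cons h p ih =>
    have := hφ _ _ h
    rw [SimpleGraph.Walk.length_cons]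
    omega

end general

/-! ### The graph: a union of five boxes in the integer lattice with king moves -/

def InBox (l₁ u₁ l₂ u₂ l₃ u₃ a b c : ℕ) : Prop :=
  (l₁ ≤ a ∧ a ≤ u₁) ∧ (l₂ ≤ b ∧ b ≤ u₂) ∧ (l₃ ≤ c ∧ c ≤ u₃)

def Reg (k a b c : ℕ) : Prop :=
  InBox 0 k (2 * k) (4 * k) (2 * k) (4 * k) a b c ∨
  InBox k (2 * k) k (3 * k) k (3 * k) a b c ∨
  InBox (2 * k) (3 * k) 0 (2 * k) 0 k a b c ∨
  InBox (2 * k) (3 * k) (2 * k) (3 * k) k (2 * k) a b c ∨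
  InBox (3 * k + 1) (4 * k + 1) (2 * k + 1) (4 * k + 1) 0 k a b c

def Vert (k : ℕ) : Type := {p : ℕ × ℕ × ℕ // Reg k p.1 p.2.1 p.2.2}

lemma finite_vert (k : ℕ) : Finite (Vert k) := by
  apply Set.Finite.to_subtype (s := {p : ℕ × ℕ × ℕ | Reg k p.1 p.2.1 p.2.2})
  apply Set.Finite.subset (Set.finite_Iic ((4 * k + 1, 4 * k + 1, 4 * k + 1) : ℕ × ℕ × ℕ))
  rintro ⟨a, b, c⟩ h
  simp only [Set.mem_ofPred_eq, Reg, InBox] at h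
  simp only [Set.mem_Iic, Prod.mk_le_mk]
  omega

namespace Vert
variable {k : ℕ}
def a (p : Vert k) : ℕ := p.1.1
def b (p : Vert k) : ℕ := p.1.2.1
def c (p : Vert k) : ℕ := p.1.2.2

lemma reg (p : Vert k) : Reg k p.a p.b p.c := p.2

def mk (x y z : ℕ) (h : Reg k x y z) : Vert k := ⟨(x, y, z), h⟩

@[simp] lemma mk_a (x y z : ℕ) (h : Reg k x y z) : (mk x y z h).a = x := rfl
@[simp] lemma mk_b (x y z : ℕ) (h : Reg k x y z) : (mk x y z h).b = y := rfl
@[simp] lemma mk_c (x y z : ℕ) (h : Reg k x y z) : (mk x y z h).c = z := rfl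

lemma ext' {p q : Vert k} (h₁ : p.a = q.a) (h₂ : p.b = q.b) (h₃ : p.c = q.c) : p = q :=
  Subtype.ext (Prod.ext h₁ (Prod.ext h₂ h₃))
end Vert

/-- Chebyshev distance at most `n`. -/
def Cheb {k : ℕ} (n : ℕ) (p q : Vert k) : Prop :=
  (p.a ≤ q.a + n ∧ q.a ≤ p.a + n) ∧ (p.b ≤ q.b + n ∧ q.b ≤ p.b + n) ∧
    (p.c ≤ q.c + n ∧ q.c ≤ p.c + n)

def J (k : ℕ) : SimpleGraph (Vert k) where
  Adj p q := p ≠ q ∧ Cheb 1 p q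
  symm := ⟨fun p q h => ⟨h.1.symm, by have := h.2; unfold Cheb at *; omega⟩⟩
  loopless := ⟨fun p h => h.1 rfl⟩

lemma near_one {k : ℕ} {p q : Vert k} (h : Cheb 1 p q) : Near (J k) 1 p q := by
  by_cases e : p = q
  · subst e
    exact ⟨SimpleGraph.Walk.nil, by simp⟩
  · have : (J k).Adj p q := ⟨e, h⟩
    exact ⟨this.toWalk, by simp⟩

/-- One step from `x` towards `y`. -/
def stp (x y : ℕ) : ℕ := if x < y then x + 1 else if y < x then x - 1 else x

lemma near_box {k l₁ u₁ l₂ u₂ l₃ u₃ : ℕ}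
    (hB : ∀ a b c, InBox l₁ u₁ l₂ u₂ l₃ u₃ a b c → Reg k a b c) (n : ℕ) (p q : Vert k)
    (hp : InBox l₁ u₁ l₂ u₂ l₃ u₃ p.a p.b p.c) (hq : InBox l₁ u₁ l₂ u₂ l₃ u₃ q.a q.b q.c)
    (h : Cheb n p q) : Near (J k) n p q := by
  induction n generalizing p with
  | zero =>
    have : p = q := by
      unfold Cheb at h
      apply Vert.ext' <;> omega
    subst this
    exact ⟨SimpleGraph.Walk.nil, by simp⟩
  | succ n ih =>
    have hr : InBox l₁ u₁ l₂ u₂ l₃ u₃ (stp p.a q.a) (stp p.b q.b) (stp p.c q.c) := by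
      unfold InBox stp at *
      refine ⟨?_, ?_, ?_⟩ <;> split_ifs <;> omega
    have h1 : Cheb 1 p (Vert.mk _ _ _ (hB _ _ _ hr)) := by
      simp only [Cheb, Vert.mk_a, Vert.mk_b, Vert.mk_c, stp]
      refine ⟨?_, ?_, ?_⟩ <;> split_ifs <;> omega
    have h2 : Cheb n (Vert.mk _ _ _ (hB _ _ _ hr)) q := by
      simp only [Cheb, Vert.mk_a, Vert.mk_b, Vert.mk_c, stp] at h ⊢
      refine ⟨?_, ?_, ?_⟩ <;> split_ifs <;> omega
    exact ((near_one h1).trans (ih _ hr h2)).mono (by omega)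

section pieces
variable {k : ℕ}

def B₁ (p : Vert k) : Prop := InBox 0 k (2 * k) (4 * k) (2 * k) (4 * k) p.a p.b p.c
def B₂ (p : Vert k) : Prop := InBox k (2 * k) k (3 * k) k (3 * k) p.a p.b p.c
def B₃ (p : Vert k) : Prop := InBox (2 * k) (3 * k) 0 (2 * k) 0 k p.a p.b p.c
def B₄ (p : Vert k) : Prop := InBox (2 * k) (3 * k) (2 * k) (3 * k) k (2 * k) p.a p.b p.c
def B₅ (p : Vert k) : Prop :=
  InBox (3 * k + 1) (4 * k + 1) (2 * k + 1) (4 * k + 1) 0 k p.a p.b p.c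

lemma near₁ (n : ℕ) {p q : Vert k} (hp : B₁ p) (hq : B₁ q) (h : Cheb n p q) : Near (J k) n p q :=
  near_box (fun _ _ _ h => Or.inl h) n p q hp hq h
lemma near₂ (n : ℕ) {p q : Vert k} (hp : B₂ p) (hq : B₂ q) (h : Cheb n p q) : Near (J k) n p q :=
  near_box (fun _ _ _ h => Or.inr (Or.inl h)) n p q hp hq h
lemma near₃ (n : ℕ) {p q : Vert k} (hp : B₃ p) (hq : B₃ q) (h : Cheb n p q) : Near (J k) n p q :=
  near_box (fun _ _ _ h => Or.inr (Or.inr (Or.inl h))) n p q hp hq h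
lemma near₄ (n : ℕ) {p q : Vert k} (hp : B₄ p) (hq : B₄ q) (h : Cheb n p q) : Near (J k) n p q :=
  near_box (fun _ _ _ h => Or.inr (Or.inr (Or.inr (Or.inl h)))) n p q hp hq h
lemma near₅ (n : ℕ) {p q : Vert k} (hp : B₅ p) (hq : B₅ q) (h : Cheb n p q) : Near (J k) n p q :=
  near_box (fun _ _ _ h => Or.inr (Or.inr (Or.inr (Or.inr h)))) n p q hp hq h

lemma cases5 (p : Vert k) : B₁ p ∨ B₂ p ∨ B₃ p ∨ B₄ p ∨ B₅ p := p.reg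

/- The hubs. -/
def hO : Vert k := Vert.mk k (3 * k) (3 * k) (by unfold Reg InBox; omega)
def hK : Vert k := Vert.mk k (2 * k) (2 * k) (by unfold Reg InBox; omega)
def hS : Vert k := Vert.mk (2 * k) (3 * k) (2 * k) (by unfold Reg InBox; omega)
def hP : Vert k := Vert.mk (2 * k) k k (by unfold Reg InBox; omega)
def hM : Vert k := Vert.mk (3 * k) (3 * k) k (by unfold Reg InBox; omega)
def hR : Vert k := Vert.mk (3 * k + 1) (3 * k + 1) k (by unfold Reg InBox; omega)
def hQ : Vert k := Vert.mk (3 * k) (2 * k) k (by unfold Reg InBox; omega)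
def hQ' : Vert k := Vert.mk (3 * k + 1) (2 * k + 1) k (by unfold Reg InBox; omega)
/-- Vertices of the central path. -/
def pv (t : ℕ) : Vert k :=
  if h : t ≤ 2 * k then Vert.mk t (3 * k - t) (3 * k - t) (by unfold Reg InBox; omega)
  else if h' : t ≤ 4 * k + 1 then Vert.mk t (t - k) k (by unfold Reg InBox; omega)
  else hP
/-- Vertices of the bad diameter. -/
def dv (m : ℕ) : Vert k :=
  if h : m ≤ 2 * k then Vert.mk (3 * k) m 0 (by unfold Reg InBox; omega)
  else if h' : m ≤ 4 * k + 1 then Vert.mk (3 * k + 1) m 0 (by unfold Reg InBox; omega)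
  else hP
def xv : Vert k := Vert.mk 0 (4 * k) (4 * k) (by unfold Reg InBox; omega)

/- Links between hubs and boxes. -/
lemma link_OS : Near (J k) k hO hS := near₂ k
  (by simp only [B₂, InBox, hO, Vert.mk_a, Vert.mk_b, Vert.mk_c]; omega)
  (by simp only [B₂, InBox, hS, Vert.mk_a, Vert.mk_b, Vert.mk_c]; omega)
  (by simp only [Cheb, hO, hS, Vert.mk_a, Vert.mk_b, Vert.mk_c]; omega)
lemma link_KP : Near (J k) k hK hP := near₂ k
  (by simp only [B₂, InBox, hK, Vert.mk_a, Vert.mk_b, Vert.mk_c]; omega)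
  (by simp only [B₂, InBox, hP, Vert.mk_a, Vert.mk_b, Vert.mk_c]; omega)
  (by simp only [Cheb, hK, hP, Vert.mk_a, Vert.mk_b, Vert.mk_c]; omega)
lemma link_SM : Near (J k) k hS hM := near₄ k
  (by simp only [B₄, InBox, hS, Vert.mk_a, Vert.mk_b, Vert.mk_c]; omega)
  (by simp only [B₄, InBox, hM, Vert.mk_a, Vert.mk_b, Vert.mk_c]; omega)
  (by simp only [Cheb, hS, hM, Vert.mk_a, Vert.mk_b, Vert.mk_c]; omega)
lemma link_MR : Near (J k) 1 hM hR := near_one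
  (by simp only [Cheb, hM, hR, Vert.mk_a, Vert.mk_b, Vert.mk_c]; omega)
lemma link_Q : Near (J k) 1 hQ hQ' := near_one
  (by simp only [Cheb, hQ, hQ', Vert.mk_a, Vert.mk_b, Vert.mk_c]; omega)

lemma b1_O {p : Vert k} (h : B₁ p) : Near (J k) k p hO := near₁ k h
  (by simp only [B₁, InBox, hO, Vert.mk_a, Vert.mk_b, Vert.mk_c]; omega)
  (by simp only [B₁, InBox, Cheb, hO, Vert.mk_a, Vert.mk_b, Vert.mk_c] at *; omega)
lemma b1_K {p : Vert k} (h : B₁ p) : Near (J k) (2 * k) p hK := near₁ (2 * k) h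
  (by simp only [B₁, InBox, hK, Vert.mk_a, Vert.mk_b, Vert.mk_c]; omega)
  (by simp only [B₁, InBox, Cheb, hK, Vert.mk_a, Vert.mk_b, Vert.mk_c] at *; omega)
lemma b2_O {p : Vert k} (h : B₂ p) : Near (J k) (2 * k) p hO := near₂ (2 * k) h
  (by simp only [B₂, InBox, hO, Vert.mk_a, Vert.mk_b, Vert.mk_c]; omega)
  (by simp only [B₂, InBox, Cheb, hO, Vert.mk_a, Vert.mk_b, Vert.mk_c] at *; omega)
lemma b2_S {p : Vert k} (h : B₂ p) : Near (J k) (2 * k) p hS := near₂ (2 * k) h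
  (by simp only [B₂, InBox, hS, Vert.mk_a, Vert.mk_b, Vert.mk_c]; omega)
  (by simp only [B₂, InBox, Cheb, hS, Vert.mk_a, Vert.mk_b, Vert.mk_c] at *; omega)
lemma b2_P {p : Vert k} (h : B₂ p) : Near (J k) (2 * k) p hP := near₂ (2 * k) h
  (by simp only [B₂, InBox, hP, Vert.mk_a, Vert.mk_b, Vert.mk_c]; omega)
  (by simp only [B₂, InBox, Cheb, hP, Vert.mk_a, Vert.mk_b, Vert.mk_c] at *; omega)
lemma b3_P {p : Vert k} (h : B₃ p) : Near (J k) k p hP := near₃ k h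
  (by simp only [B₃, InBox, hP, Vert.mk_a, Vert.mk_b, Vert.mk_c]; omega)
  (by simp only [B₃, InBox, Cheb, hP, Vert.mk_a, Vert.mk_b, Vert.mk_c] at *; omega)
lemma b3_Q {p : Vert k} (h : B₃ p) : Near (J k) (2 * k) p hQ := near₃ (2 * k) h
  (by simp only [B₃, InBox, hQ, Vert.mk_a, Vert.mk_b, Vert.mk_c]; omega)
  (by simp only [B₃, InBox, Cheb, hQ, Vert.mk_a, Vert.mk_b, Vert.mk_c] at *; omega)
lemma b4_S {p : Vert k} (h : B₄ p) : Near (J k) k p hS := near₄ k h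
  (by simp only [B₄, InBox, hS, Vert.mk_a, Vert.mk_b, Vert.mk_c]; omega)
  (by simp only [B₄, InBox, Cheb, hS, Vert.mk_a, Vert.mk_b, Vert.mk_c] at *; omega)
lemma b4_M {p : Vert k} (h : B₄ p) : Near (J k) k p hM := near₄ k h
  (by simp only [B₄, InBox, hM, Vert.mk_a, Vert.mk_b, Vert.mk_c]; omega)
  (by simp only [B₄, InBox, Cheb, hM, Vert.mk_a, Vert.mk_b, Vert.mk_c] at *; omega)
lemma b4_Q {p : Vert k} (h : B₄ p) : Near (J k) k p hQ := near₄ k h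
  (by simp only [B₄, InBox, hQ, Vert.mk_a, Vert.mk_b, Vert.mk_c]; omega)
  (by simp only [B₄, InBox, Cheb, hQ, Vert.mk_a, Vert.mk_b, Vert.mk_c] at *; omega)
lemma b5_R {p : Vert k} (h : B₅ p) : Near (J k) k p hR := near₅ k h
  (by simp only [B₅, InBox, hR, Vert.mk_a, Vert.mk_b, Vert.mk_c]; omega)
  (by simp only [B₅, InBox, Cheb, hR, Vert.mk_a, Vert.mk_b, Vert.mk_c] at *; omega)
lemma b5_Q {p : Vert k} (h : B₅ p) : Near (J k) (2 * k) p hQ' := near₅ (2 * k) h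
  (by simp only [B₅, InBox, hQ', Vert.mk_a, Vert.mk_b, Vert.mk_c]; omega)
  (by simp only [B₅, InBox, Cheb, hQ', Vert.mk_a, Vert.mk_b, Vert.mk_c] at *; omega)

lemma d11 {p q : Vert k} (hp : B₁ p) (hq : B₁ q) : Near (J k) (4 * k + 1) p q :=
  ((b1_O hp).trans (b1_O hq).symm).mono (by omega)
lemma d12 {p q : Vert k} (hp : B₁ p) (hq : B₂ q) : Near (J k) (4 * k + 1) p q :=
  ((b1_O hp).trans (b2_O hq).symm).mono (by omega)
lemma d13 {p q : Vert k} (hp : B₁ p) (hq : B₃ q) : Near (J k) (4 * k + 1) p q :=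
  (((b1_K hp).trans link_KP).trans (b3_P hq).symm).mono (by omega)
lemma d14 {p q : Vert k} (hp : B₁ p) (hq : B₄ q) : Near (J k) (4 * k + 1) p q :=
  (((b1_O hp).trans link_OS).trans (b4_S hq).symm).mono (by omega)
lemma d15 {p q : Vert k} (hp : B₁ p) (hq : B₅ q) : Near (J k) (4 * k + 1) p q :=
  (((((b1_O hp).trans link_OS).trans link_SM).trans link_MR).trans (b5_R hq).symm).mono (by omega)
lemma d22 {p q : Vert k} (hp : B₂ p) (hq : B₂ q) : Near (J k) (4 * k + 1) p q :=
  ((b2_O hp).trans (b2_O hq).symm).mono (by omega)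
lemma d23 {p q : Vert k} (hp : B₂ p) (hq : B₃ q) : Near (J k) (4 * k + 1) p q :=
  ((b2_P hp).trans (b3_P hq).symm).mono (by omega)
lemma d24 {p q : Vert k} (hp : B₂ p) (hq : B₄ q) : Near (J k) (4 * k + 1) p q :=
  ((b2_S hp).trans (b4_S hq).symm).mono (by omega)
lemma d25 {p q : Vert k} (hp : B₂ p) (hq : B₅ q) : Near (J k) (4 * k + 1) p q :=
  ((((b2_S hp).trans link_SM).trans link_MR).trans (b5_R hq).symm).mono (by omega)
lemma d33 {p q : Vert k} (hp : B₃ p) (hq : B₃ q) : Near (J k) (4 * k + 1) p q :=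
  ((b3_P hp).trans (b3_P hq).symm).mono (by omega)
lemma d34 {p q : Vert k} (hp : B₃ p) (hq : B₄ q) : Near (J k) (4 * k + 1) p q :=
  ((b3_Q hp).trans (b4_Q hq).symm).mono (by omega)
lemma d35 {p q : Vert k} (hp : B₃ p) (hq : B₅ q) : Near (J k) (4 * k + 1) p q :=
  (((b3_Q hp).trans link_Q).trans (b5_Q hq).symm).mono (by omega)
lemma d44 {p q : Vert k} (hp : B₄ p) (hq : B₄ q) : Near (J k) (4 * k + 1) p q :=
  ((b4_S hp).trans (b4_S hq).symm).mono (by omega)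
lemma d45 {p q : Vert k} (hp : B₄ p) (hq : B₅ q) : Near (J k) (4 * k + 1) p q :=
  (((b4_M hp).trans link_MR).trans (b5_R hq).symm).mono (by omega)
lemma d55 {p q : Vert k} (hp : B₅ p) (hq : B₅ q) : Near (J k) (4 * k + 1) p q :=
  ((b5_R hp).trans (b5_R hq).symm).mono (by omega)

lemma near_all (p q : Vert k) : Near (J k) (4 * k + 1) p q := by
  rcases cases5 p with hp | hp | hp | hp | hp <;> rcases cases5 q with hq | hq | hq | hq | hq
  · exact d11 hp hq
  · exact d12 hp hq
  · exact d13 hp hq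
  · exact d14 hp hq
  · exact d15 hp hq
  · exact (d12 hq hp).symm
  · exact d22 hp hq
  · exact d23 hp hq
  · exact d24 hp hq
  · exact d25 hp hq
  · exact (d13 hq hp).symm
  · exact (d23 hq hp).symm
  · exact d33 hp hq
  · exact d34 hp hq
  · exact d35 hp hq
  · exact (d14 hq hp).symm
  · exact (d24 hq hp).symm
  · exact (d34 hq hp).symm
  · exact d44 hp hq
  · exact d45 hp hq
  · exact (d15 hq hp).symm
  · exact (d25 hq hp).symm
  · exact (d35 hq hp).symm
  · exact (d45 hq hp).symm
  · exact d55 hp hq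

lemma connected : (J k).Connected := by
  have : Nonempty (Vert k) := ⟨hO⟩
  refine ⟨fun p q => ?_⟩
  obtain ⟨w, -⟩ := near_all p q
  exact ⟨w⟩

lemma pv_lo {t : ℕ} (h : t ≤ 2 * k) :
    (pv t : Vert k).a = t ∧ (pv t : Vert k).b = 3 * k - t ∧ (pv t : Vert k).c = 3 * k - t := by
  unfold pv; rw [dif_pos h]; exact ⟨rfl, rfl, rfl⟩
lemma pv_hi {t : ℕ} (h : 2 * k < t) (h' : t ≤ 4 * k + 1) :
    (pv t : Vert k).a = t ∧ (pv t : Vert k).b = t - k ∧ (pv t : Vert k).c = k := by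
  unfold pv; rw [dif_neg (by omega), dif_pos h']; exact ⟨rfl, rfl, rfl⟩
lemma dv_lo {t : ℕ} (h : t ≤ 2 * k) :
    (dv t : Vert k).a = 3 * k ∧ (dv t : Vert k).b = t ∧ (dv t : Vert k).c = 0 := by
  unfold dv; rw [dif_pos h]; exact ⟨rfl, rfl, rfl⟩
lemma dv_hi {t : ℕ} (h : 2 * k < t) (h' : t ≤ 4 * k + 1) :
    (dv t : Vert k).a = 3 * k + 1 ∧ (dv t : Vert k).b = t ∧ (dv t : Vert k).c = 0 := by
  unfold dv; rw [dif_neg (by omega), dif_pos h']; exact ⟨rfl, rfl, rfl⟩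

lemma pv_adj {t : ℕ} (h : t < 4 * k + 1) : (J k).Adj (pv t) (pv (t + 1)) := by
  have h1 := @pv_lo k t
  have h2 := @pv_hi k t
  have h3 := @pv_lo k (t + 1)
  have h4 := @pv_hi k (t + 1)
  constructor
  · intro e
    rw [e] at h1 h2
    omega
  · unfold Cheb
    omega

lemma dv_adj {t : ℕ} (h : t < 4 * k + 1) : (J k).Adj (dv t) (dv (t + 1)) := by
  have h1 := @dv_lo k t
  have h2 := @dv_hi k t
  have h3 := @dv_lo k (t + 1)
  have h4 := @dv_hi k (t + 1)
  constructor
  · intro e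
    rw [e] at h1 h2
    omega
  · unfold Cheb
    omega

/-- Every vertex is within `k` of the central path. -/
lemma near_path (x : Vert k) : ∃ t ≤ 4 * k + 1, Near (J k) k x (pv t) := by
  rcases cases5 x with h | h | h | h | h
  · have e := @pv_lo k 0 (by omega)
    exact ⟨0, by omega, near₁ k h (by simp only [B₁, InBox]; omega)
      (by simp only [B₁, InBox, Cheb] at *; omega)⟩
  · have e := @pv_lo k k (by omega)
    exact ⟨k, by omega, near₂ k h (by simp only [B₂, InBox]; omega)
      (by simp only [B₂, InBox, Cheb] at *; omega)⟩
  · have e := @pv_lo k (2 * k) (by omega)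
    exact ⟨2 * k, by omega, near₃ k h (by simp only [B₃, InBox]; omega)
      (by simp only [B₃, InBox, Cheb] at *; omega)⟩
  · have e := @pv_lo k (3 * k)
    have e' := @pv_hi k (3 * k)
    exact ⟨3 * k, by omega, near₄ k h (by simp only [B₄, InBox]; omega)
      (by simp only [B₄, InBox, Cheb] at *; omega)⟩
  · have e' := @pv_hi k (4 * k + 1) (by omega) (by omega)
    exact ⟨4 * k + 1, by omega, near₅ k h (by simp only [B₅, InBox]; omega)
      (by simp only [B₅, InBox, Cheb] at *; omega)⟩

lemma main (k : ℕ) [Fintype (Vert k)] : minK (J k) = k ∧ maxS (J k) = 4 * k := by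
  obtain ⟨P, hPl, hPs⟩ := exists_walk_seq (G := J k) pv (4 * k + 1) fun i hi => pv_adj hi
  obtain ⟨D, hDl, hDs⟩ := exists_walk_seq (G := J k) dv (4 * k + 1) fun i hi => dv_adj hi
  have hPd := lip_dist (connected (k := k)) Vert.a (fun x y h => h.2.1.2) (pv 0) (pv (4 * k + 1))
  have hDd := lip_dist (connected (k := k)) Vert.b (fun x y h => h.2.2.1.2) (dv 0) (dv (4 * k + 1))
  have e1 := @pv_lo k 0 (by omega)
  have e2 := @pv_hi k (4 * k + 1) (by omega) (by omega)
  have e3 := @dv_lo k 0 (by omega)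
  have e4 := @dv_hi k (4 * k + 1) (by omega) (by omega)
  have hP' := (near_all (pv 0 : Vert k) (pv (4 * k + 1))).dist_le
  have hD' := (near_all (dv 0 : Vert k) (dv (4 * k + 1))).dist_le
  refine main_reduction connected k P ?_ D ⟨?_, ?_⟩ ?_ ?_
  · unfold IsShortestPath
    omega
  · unfold IsShortestPath
    omega
  · intro x y
    rw [hDl]
    exact (near_all x y).dist_le
  · rw [walkEcc_le_iff]
    intro x
    obtain ⟨t, ht, hn⟩ := near_path x
    exact ⟨pv t, (hPs _).2 ⟨t, ht, rfl⟩, hn.dist_le⟩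
  · obtain ⟨w, hw, hd⟩ := (walkEcc_le_iff D _).1 le_rfl xv
    obtain ⟨m, hm, rfl⟩ := (hDs _).1 hw
    have hl := lip_dist (connected (k := k)) Vert.c (fun x y h => h.2.2.2.2) (dv m) xv
    rw [SimpleGraph.dist_comm] at hl
    have e5 := @dv_lo k m
    have e6 := @dv_hi k m
    have e7 : (xv : Vert k).c = 4 * k := rfl
    omega

end pieces

end JK

theorem stmt18 :
    ∀ k : ℕ, 1 ≤ k →
      ∃ (V : Type) (_ : Fintype V) (G : SimpleGraph V), G.Connected ∧
        minK G = k ∧ maxS G = 4 * k := by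
  intro k _
  haveI := JK.finite_vert k
  letI : Fintype (JK.Vert k) := Fintype.ofFinite _
  exact ⟨JK.Vert k, inferInstance, JK.J k, JK.connected, JK.main k⟩
end
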